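/- Let ≺ be an admissible order on FreeMonoid σ and let I and I' be two-sided ideals of A = FreeAlgebra K σ such that the ideal generated by tip(I) equals the ideal generated by tip(I'). Then A/I and A/I' are isomorphic as K-vector spaces; in particular dim_K(A/I) = dim_K(A/I'). -/

import Mathlib

open scoped TensorProduct

noncomputable section

/-- The embedding of words into the free algebra, sending a word to the product of the
corresponding generators. -/
def wordEmb (K : Type*) [Field K] (σ : Type*) : FreeMonoid σ →* FreeAlgebra K σ :=
  FreeMonoid.lift (FreeAlgebra.ι K)

/-- The coefficient function of an element of the free algebra with respect to the word basis. -/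
def coeffw (K : Type*) [Field K] (σ : Type*) (x : FreeAlgebra K σ) : FreeMonoid σ →₀ K :=
  (FreeAlgebra.basisFreeMonoid K σ).repr x

/-- A `K`-submodule of the free algebra is a two-sided ideal if it is closed under
left and right multiplication by arbitrary elements. -/
def IsIdeal2 (K : Type*) [Field K] (σ : Type*) (I : Submodule K (FreeAlgebra K σ)) : Prop :=
  ∀ a b : FreeAlgebra K σ, ∀ x ∈ I, a * x * b ∈ I

/-- The two-sided ideal generated by a set `S`. -/
def idealGen (K : Type*) [Field K] (σ : Type*) (S : Set (FreeAlgebra K σ)) :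
    Submodule K (FreeAlgebra K σ) :=
  Submodule.span K {x | ∃ a s b, s ∈ S ∧ x = a * s * b}

/-- `lt` is an admissible order on `FreeMonoid σ`: a well-order compatible with
multiplication on both sides, and such that a word is ≤ any word containing it as a factor. -/
structure IsAdmissibleOrder {σ : Type*} (lt : FreeMonoid σ → FreeMonoid σ → Prop) : Prop where
  isWellOrder : IsWellOrder (FreeMonoid σ) lt
  mul_right : ∀ p q r : FreeMonoid σ, lt p q → lt (p * r) (q * r)
  mul_left : ∀ p q s : FreeMonoid σ, lt p q → lt (s * p) (s * q)
  le_mul : ∀ q r s : FreeMonoid σ, q = r * q * s ∨ lt q (r * q * s)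

/-- A length admissible order is an admissible order in which longer words are larger. -/
structure IsLengthAdmissibleOrder {σ : Type*} (lt : FreeMonoid σ → FreeMonoid σ → Prop)
    extends IsAdmissibleOrder lt : Prop where
  length_lt : ∀ p q : FreeMonoid σ, p.length < q.length → lt p q

/-- `t` is the tip (the largest word of the support with respect to `lt`) of `x`. -/
def IsTipOf (K : Type*) [Field K] {σ : Type*} (lt : FreeMonoid σ → FreeMonoid σ → Prop)
    (t : FreeMonoid σ) (x : FreeAlgebra K σ) : Prop :=
  coeffw K σ x t ≠ 0 ∧ ∀ u, coeffw K σ x u ≠ 0 → u = t ∨ lt u t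

/-- The set of tips of the nonzero elements of `S`. -/
def tipSet (K : Type*) [Field K] {σ : Type*} (lt : FreeMonoid σ → FreeMonoid σ → Prop)
    (S : Set (FreeAlgebra K σ)) : Set (FreeMonoid σ) :=
  {t | ∃ x ∈ S, IsTipOf K lt t x}

/-- The set of nontips of `S`: words which are not a tip of an element of `S`. -/
def nontipSet (K : Type*) [Field K] {σ : Type*} (lt : FreeMonoid σ → FreeMonoid σ → Prop)
    (S : Set (FreeAlgebra K σ)) : Set (FreeMonoid σ) :=
  {w | w ∉ tipSet K lt S}

/-- `G` is a Gröbner basis of the two-sided ideal `I` with respect to `lt`. -/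
def IsGrobnerBasis (K : Type*) [Field K] {σ : Type*}
    (lt : FreeMonoid σ → FreeMonoid σ → Prop) (G : Set (FreeAlgebra K σ))
    (I : Submodule K (FreeAlgebra K σ)) : Prop :=
  G ⊆ ↑I ∧ idealGen K σ (wordEmb K σ '' tipSet K lt G) = idealGen K σ (wordEmb K σ '' tipSet K lt ↑I)

/-- `x` is homogeneous of degree `d`: every word in its support has length `d`. -/
def IsHomogOfDeg (K : Type*) [Field K] {σ : Type*} (x : FreeAlgebra K σ) (d : ℕ) : Prop :=
  ∀ w : FreeMonoid σ, coeffw K σ x w ≠ 0 → w.length = d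


theorem basis_eq_wordEmb (K : Type*) [Field K] (σ : Type*) (w : FreeMonoid σ) :
    FreeAlgebra.basisFreeMonoid K σ w = wordEmb K σ w := by
  simp [FreeAlgebra.basisFreeMonoid, wordEmb, FreeAlgebra.equivMonoidAlgebraFreeMonoid,
    MonoidAlgebra.coeffLinearEquiv]

theorem mem_span_words (K : Type*) [Field K] (σ : Type*) (x : FreeAlgebra K σ)
    (s : Set (FreeMonoid σ)) :
    x ∈ Submodule.span K (wordEmb K σ '' s) ↔ ∀ u, coeffw K σ x u ≠ 0 → u ∈ s := by
  have : (wordEmb K σ : FreeMonoid σ → FreeAlgebra K σ) = FreeAlgebra.basisFreeMonoid K σ := by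
    ext w; exact (basis_eq_wordEmb K σ w).symm
  rw [this, Module.Basis.mem_span_image]
  simp only [Set.subset_def, Finset.mem_coe, Finsupp.mem_support_iff, coeffw]

theorem coeffw_word (K : Type*) [Field K] (σ : Type*) (w u : FreeMonoid σ) :
    coeffw K σ (wordEmb K σ w) u = Finsupp.single w (1 : K) u := by
  rw [coeffw, ← basis_eq_wordEmb, Module.Basis.repr_self]

theorem isTipOf_iff (K : Type*) [Field K] {σ : Type*} (lt : FreeMonoid σ → FreeMonoid σ → Prop)
    (hlt : IsAdmissibleOrder lt) (t : FreeMonoid σ) (x : FreeAlgebra K σ) :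
    IsTipOf K lt t x ↔ ∃ c : K, c ≠ 0 ∧
      x - c • wordEmb K σ t ∈ Submodule.span K (wordEmb K σ '' {u | lt u t}) := by
  have hirr : ∀ u, ¬ lt u u := fun u => by
    haveI := hlt.isWellOrder
    exact irrefl_of lt u
  have hc : ∀ (c : K) (u : FreeMonoid σ), coeffw K σ (x - c • wordEmb K σ t) u
      = coeffw K σ x u - c * Finsupp.single t (1 : K) u := fun c u => by
    rw [← coeffw_word]; simp [coeffw]
  constructor
  · rintro ⟨h1, h2⟩
    refine ⟨coeffw K σ x t, h1, ?_⟩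
    rw [mem_span_words]
    intro u hu
    rw [hc] at hu
    by_cases hut : u = t
    · subst hut; simp at hu
    · rw [Finsupp.single_eq_of_ne hut] at hu
      exact (h2 u (by simpa using hu)).resolve_left hut
  · rintro ⟨c, hc0, hm⟩
    rw [mem_span_words] at hm
    refine ⟨fun h0 => hirr t (hm t ?_), fun u hu => ?_⟩
    · rw [hc, h0]; simpa using hc0
    · by_cases hut : u = t
      · exact Or.inl hut
      · refine Or.inr (hm u ?_)
        rw [hc, Finsupp.single_eq_of_ne hut]; simpa using hu

theorem exists_tip (K : Type*) [Field K] {σ : Type*} (lt : FreeMonoid σ → FreeMonoid σ → Prop)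
    (hlt : IsAdmissibleOrder lt) (x : FreeAlgebra K σ) (hx : x ≠ 0) : ∃ t, IsTipOf K lt t x := by
  classical
  haveI := hlt.isWellOrder
  letI : LinearOrder (FreeMonoid σ) := linearOrderOfSTO lt
  have hne : (coeffw K σ x).support.Nonempty := by
    rw [Finsupp.support_nonempty_iff]
    simpa [coeffw] using hx
  refine ⟨(coeffw K σ x).support.max' hne, ?_, ?_⟩
  · exact Finsupp.mem_support_iff.1 (Finset.max'_mem _ hne)
  · intro u hu
    exact (Finset.le_max' _ u (Finsupp.mem_support_iff.2 hu)).eq_or_lt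

theorem tip_mul (K : Type*) [Field K] {σ : Type*} (lt : FreeMonoid σ → FreeMonoid σ → Prop)
    (hlt : IsAdmissibleOrder lt) (I : Submodule K (FreeAlgebra K σ)) (hI : IsIdeal2 K σ I)
    (r t s : FreeMonoid σ) (ht : t ∈ tipSet K lt (I : Set (FreeAlgebra K σ))) :
    r * t * s ∈ tipSet K lt (I : Set (FreeAlgebra K σ)) := by
  obtain ⟨x, hx, hxt⟩ := ht
  refine ⟨wordEmb K σ r * x * wordEmb K σ s, hI _ _ x hx, ?_⟩
  rw [isTipOf_iff K lt hlt] at hxt ⊢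
  obtain ⟨c, hc, hm⟩ := hxt
  refine ⟨c, hc, ?_⟩
  have key : ∀ y ∈ Submodule.span K (wordEmb K σ '' {u | lt u t}),
      wordEmb K σ r * y * wordEmb K σ s ∈
        Submodule.span K (wordEmb K σ '' {u | lt u (r * t * s)}) := by
    intro y hy
    induction hy using Submodule.span_induction with
    | mem y hy =>
      obtain ⟨u, hu, rfl⟩ := hy
      rw [← map_mul, ← map_mul]
      exact Submodule.subset_span ⟨_, hlt.mul_right _ _ _ (hlt.mul_left _ _ _ hu), rfl⟩
    | zero => simp
    | add a b _ _ ha hb => rw [mul_add, add_mul]; exact add_mem ha hb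
    | smul k a _ ha =>
      rw [mul_smul_comm, smul_mul_assoc]; exact Submodule.smul_mem _ _ ha
  have := key _ hm
  rwa [mul_sub, sub_mul, mul_smul_comm, smul_mul_assoc, ← map_mul, ← map_mul] at this

theorem span_words_univ (K : Type*) [Field K] (σ : Type*) (a : FreeAlgebra K σ) :
    a ∈ Submodule.span K (wordEmb K σ '' Set.univ) := by
  rw [mem_span_words]; intros; trivial

theorem idealGen_tip (K : Type*) [Field K] {σ : Type*} (lt : FreeMonoid σ → FreeMonoid σ → Prop)
    (hlt : IsAdmissibleOrder lt) (I : Submodule K (FreeAlgebra K σ)) (hI : IsIdeal2 K σ I) :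
    idealGen K σ (wordEmb K σ '' tipSet K lt (I : Set (FreeAlgebra K σ))) =
      Submodule.span K (wordEmb K σ '' tipSet K lt (I : Set (FreeAlgebra K σ))) := by
  apply le_antisymm
  · refine Submodule.span_le.2 ?_
    rintro _ ⟨a, _, b, ⟨t, ht, rfl⟩, rfl⟩
    have ha := span_words_univ K σ a
    have hb := span_words_univ K σ b
    rw [SetLike.mem_coe]
    induction ha using Submodule.span_induction with
    | mem y hy =>
      obtain ⟨r, -, rfl⟩ := hy
      induction hb using Submodule.span_induction with
      | mem z hz =>
        obtain ⟨s, -, rfl⟩ := hz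
        rw [← map_mul, ← map_mul]
        exact Submodule.subset_span ⟨_, tip_mul K lt hlt I hI r t s ht, rfl⟩
      | zero => simp
      | add a b _ _ ha hb => rw [mul_add]; exact add_mem ha hb
      | smul k a _ ha => rw [mul_smul_comm]; exact Submodule.smul_mem _ _ ha
    | zero => simp
    | add a b _ _ ha hb => rw [add_mul, add_mul]; exact add_mem ha hb
    | smul k a _ ha =>
      rw [smul_mul_assoc, smul_mul_assoc]; exact Submodule.smul_mem _ _ ha
  · exact Submodule.span_mono fun x hx => ⟨1, x, 1, hx, by simp⟩

theorem mem_tipSet_iff (K : Type*) [Field K] {σ : Type*}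
    (lt : FreeMonoid σ → FreeMonoid σ → Prop)
    (hlt : IsAdmissibleOrder lt) (I : Submodule K (FreeAlgebra K σ)) (hI : IsIdeal2 K σ I)
    (w : FreeMonoid σ) : w ∈ tipSet K lt (I : Set (FreeAlgebra K σ)) ↔
      wordEmb K σ w ∈ idealGen K σ (wordEmb K σ '' tipSet K lt (I : Set (FreeAlgebra K σ))) := by
  rw [idealGen_tip K lt hlt I hI]
  refine ⟨fun hw => Submodule.subset_span ⟨w, hw, rfl⟩, fun hw => ?_⟩
  rw [mem_span_words] at hw
  exact hw w (by rw [coeffw_word]; simp)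

theorem isCompl_nontip (K : Type*) [Field K] {σ : Type*}
    (lt : FreeMonoid σ → FreeMonoid σ → Prop)
    (hlt : IsAdmissibleOrder lt) (I : Submodule K (FreeAlgebra K σ)) :
    IsCompl I (Submodule.span K
      (wordEmb K σ '' nontipSet K lt (I : Set (FreeAlgebra K σ)))) := by
  constructor
  · rw [Submodule.disjoint_def]
    intro x hx hxN
    by_contra hx0
    obtain ⟨t, ht⟩ := exists_tip K lt hlt x hx0
    rw [mem_span_words] at hxN
    exact hxN t ht.1 ⟨x, hx, ht⟩
  · rw [codisjoint_iff, eq_top_iff]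
    set N := Submodule.span K (wordEmb K σ '' nontipSet K lt (I : Set (FreeAlgebra K σ))) with hN
    have key : ∀ w, wordEmb K σ w ∈ I ⊔ N := by
      intro w
      induction w using hlt.isWellOrder.wf.induction with
      | _ w ih =>
      by_cases hw : w ∈ tipSet K lt (I : Set (FreeAlgebra K σ))
      · obtain ⟨x, hx, hxw⟩ := hw
        obtain ⟨c, hc, hm⟩ := (isTipOf_iff K lt hlt w x).1 hxw
        have h1 : x - c • wordEmb K σ w ∈ I ⊔ N := by
          refine Submodule.span_le.2 ?_ hm
          rintro _ ⟨u, hu, rfl⟩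
          exact ih u hu
        have h2 : c • wordEmb K σ w ∈ I ⊔ N := by
          have := sub_mem (Submodule.mem_sup_left hx : x ∈ I ⊔ N) h1
          rwa [sub_sub_cancel] at this
        exact (Submodule.smul_mem_iff _ hc).1 h2
      · exact Submodule.mem_sup_right (Submodule.subset_span ⟨w, hw, rfl⟩)
    intro x _
    refine Submodule.span_le.2 ?_ (span_words_univ K σ x)
    rintro _ ⟨u, -, rfl⟩
    exact key u

/-- ideals with the same tip-ideal have `K`-linearly isomorphic quotients. -/
theorem stmt9 (K : Type*) [Field K] (σ : Type*)
    (lt : FreeMonoid σ → FreeMonoid σ → Prop) (hlt : IsAdmissibleOrder lt)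
    (I I' : Submodule K (FreeAlgebra K σ)) (hI : IsIdeal2 K σ I) (hI' : IsIdeal2 K σ I')
    (h : idealGen K σ (wordEmb K σ '' tipSet K lt (I : Set (FreeAlgebra K σ)))
      = idealGen K σ (wordEmb K σ '' tipSet K lt (I' : Set (FreeAlgebra K σ)))) :
    Nonempty ((FreeAlgebra K σ ⧸ I) ≃ₗ[K] (FreeAlgebra K σ ⧸ I')) ∧
    Module.rank K (FreeAlgebra K σ ⧸ I) = Module.rank K (FreeAlgebra K σ ⧸ I') := by
  have ht : nontipSet K lt (I : Set (FreeAlgebra K σ))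
      = nontipSet K lt (I' : Set (FreeAlgebra K σ)) := by
    ext w
    simp only [nontipSet, Set.mem_setOf_eq]
    rw [mem_tipSet_iff K lt hlt I hI, mem_tipSet_iff K lt hlt I' hI', h]
  have hc := isCompl_nontip K lt hlt I
  have hc' := isCompl_nontip K lt hlt I'
  rw [← ht] at hc'
  have e := (Submodule.quotientEquivOfIsCompl _ _ hc).trans
    (Submodule.quotientEquivOfIsCompl _ _ hc').symm
  exact ⟨⟨e⟩, e.rank_eq⟩
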